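/- There exist a universal constant C<∞ and ε₀>0 (both independent of the graph G and of c) such that the following holds: for every c>0, every integer m>1, every m-regular triangle-free finite graph G on n vertices with n sufficiently large (depending on c and m), and every 0<ε<ε₀, if the KCIP on G with parameter p=c/n is started from a configuration with exactly one vertex labeled 1, then P[ζ_triple < ε·n³/(3c²m(m−1))] ≤ C·ε. -/

import Mathlib

open scoped Classical
open Finset

noncomputable section

/-- The number of particles (vertices labelled `1`) of a configuration. -/
def numParticles {V : Type*} [Fintype V] (x : V → Bool) : ℕ :=
  (Finset.univ.filter fun v => x v = true).card

/-- One-step transition kernel of the kinetically constrained Ising process (KCIP)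
on the graph `G` with density parameter `p`: a uniformly chosen vertex `v` is updated,
and its label is resampled (to `1` with probability `p`, to `0` otherwise) iff `v` has at
least one neighbour labelled `1`. -/
def kcipKernel {V : Type*} [Fintype V] (G : SimpleGraph V) (p : ℝ) (x y : V → Bool) : ℝ :=
  ((Fintype.card V : ℝ))⁻¹ * ∑ v : V,
    (if ∀ w, w ≠ v → y w = x w then
      (if ∃ u, G.Adj u v ∧ x u = true then (if y v = true then p else 1 - p)
       else (if y v = x v then 1 else 0))
     else 0)

/-- Probability that the Markov chain with kernel `K` started at `x` produces a
trajectory `(X_0, …, X_T)` lying in the event `A`. -/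
def trajProb {Ω : Type*} [Fintype Ω] (K : Ω → Ω → ℝ) (x : Ω) (T : ℕ)
    (A : (Fin (T + 1) → Ω) → Prop) : ℝ :=
  ∑ ω : Fin (T + 1) → Ω,
    if ω 0 = x ∧ A ω then ∏ i : Fin T, K (ω i.castSucc) (ω i.succ) else 0

/-- Expectation of a functional `f` of the trajectory `(X_0, …, X_T)` of the Markov chain
with kernel `K` started at `x`. -/
def trajExp {Ω : Type*} [Fintype Ω] (K : Ω → Ω → ℝ) (x : Ω) (T : ℕ)
    (f : (Fin (T + 1) → Ω) → ℝ) : ℝ :=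
  ∑ ω : Fin (T + 1) → Ω,
    (if ω 0 = x then ∏ i : Fin T, K (ω i.castSucc) (ω i.succ) else 0) * f ω

/-- The `d`-dimensional discrete torus `Z_L^d`: vertices are `Fin d → ZMod L`, with an edge
between `u` and `v` iff `u - v = ± e_i` for some coordinate vector `e_i`. -/
def torusGraph (L d : ℕ) : SimpleGraph (Fin d → ZMod L) :=
  SimpleGraph.fromRel fun u v => ∃ i : Fin d, v = u + fun j => if j = i then (1 : ZMod L) else 0

section TrajectoryBounds

variable {Ω : Type*} [Fintype Ω] {K : Ω → Ω → ℝ}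

theorem trajProb_zero (x : Ω) (A : (Fin 1 → Ω) → Prop) :
    trajProb K x 0 A = if A (fun _ => x) then 1 else 0 := by
  unfold trajProb
  rw [← (Equiv.funUnique (Fin 1) Ω).symm.sum_comp, Finset.sum_eq_single x]
  · have hx : (Equiv.funUnique (Fin 1) Ω).symm x = fun _ => x := rfl
    simp [hx]
  · intro y _ hy
    simp [Equiv.funUnique, hy]
  · simp

theorem trajProb_succ (x : Ω) (T : ℕ) (A : (Fin (T + 2) → Ω) → Prop) :
    trajProb K x (T + 1) A =
      ∑ y, K x y * trajProb K y T fun ω => A (Fin.cons x ω) := by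
  have hL : trajProb K x (T + 1) A = ∑ ω : Fin (T + 1) → Ω,
      if A (Fin.cons x ω) then K x (ω 0) * ∏ i : Fin T, K (ω i.castSucc) (ω i.succ) else 0 := by
    unfold trajProb
    rw [← (Fin.consEquiv fun _ => Ω).sum_comp, Fintype.sum_prod_type, Finset.sum_eq_single x]
    · refine Finset.sum_congr rfl fun ω _ => ?_
      simp [Fin.consEquiv, Fin.prod_univ_succ]
    · intro y _ hy
      simp [Fin.consEquiv, hy]
    · simp
  rw [hL]
  unfold trajProb
  simp_rw [Finset.mul_sum]
  rw [Finset.sum_comm]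
  refine Finset.sum_congr rfl fun ω _ => ?_
  rw [Finset.sum_eq_single (ω 0)]
  · simp
  · intro y _ hy
    simp [hy.symm]
  · simp

theorem trajProb_mono (hK : ∀ x y, 0 ≤ K x y) (x : Ω) (T : ℕ) {A B : (Fin (T + 1) → Ω) → Prop}
    (h : ∀ ω, ω 0 = x → A ω → B ω) : trajProb K x T A ≤ trajProb K x T B := by
  refine Finset.sum_le_sum fun ω _ => ?_
  have hp : 0 ≤ ∏ i : Fin T, K (ω i.castSucc) (ω i.succ) := Finset.prod_nonneg fun i _ => hK _ _
  by_cases hA : ω 0 = x ∧ A ω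
  · rw [if_pos hA, if_pos ⟨hA.1, h ω hA.1 hA.2⟩]
  · rw [if_neg hA]
    split_ifs
    exacts [hp, le_rfl]

theorem trajProb_le_one (hK : ∀ x y, 0 ≤ K x y) (hsum : ∀ x, ∑ y, K x y = 1) (x : Ω) (T : ℕ)
    (A : (Fin (T + 1) → Ω) → Prop) : trajProb K x T A ≤ 1 := by
  induction T generalizing x with
  | zero =>
    rw [trajProb_zero]
    split_ifs <;> norm_num
  | succ T ih =>
    rw [trajProb_succ, ← hsum x]
    exact Finset.sum_le_sum fun y _ => mul_le_of_le_one_right (hK x y) (ih y _)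

/-- A function that is at least one on `B` and whose drift outside `{1 ≤ h}` is at most `δ`
bounds the probability of hitting `B`. -/
theorem trajProb_hit_le (hK : ∀ x y, 0 ≤ K x y) (hsum : ∀ x, ∑ y, K x y = 1) {B : Ω → Prop}
    {h : Ω → ℝ} {δ : ℝ} (h0 : ∀ x, 0 ≤ h x) (hδ : 0 ≤ δ) (hB : ∀ x, B x → 1 ≤ h x)
    (hdrift : ∀ x, h x < 1 → ∑ y, K x y * h y ≤ h x + δ) (x : Ω) (T : ℕ) :
    trajProb K x T (fun ω => ∃ t, B (ω t)) ≤ h x + T * δ := by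
  induction T generalizing x with
  | zero =>
    rw [trajProb_zero]
    split_ifs with hx
    · simpa using hB x (by simpa using hx)
    · simpa using h0 x
  | succ T ih =>
    by_cases hx : h x < 1
    · have hxB : ¬ B x := fun hb => absurd (hB x hb) (not_le.2 hx)
      rw [trajProb_succ]
      calc ∑ y, K x y * trajProb K y T (fun ω => ∃ t, B ((Fin.cons x ω : Fin (T + 2) → Ω) t))
          ≤ ∑ y, K x y * (h y + T * δ) := by
            refine Finset.sum_le_sum fun y _ => mul_le_mul_of_nonneg_left ?_ (hK x y)
            simpa [Fin.exists_fin_succ, hxB] using ih y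
        _ = ∑ y, K x y * h y + T * δ := by
            simp_rw [mul_add, Finset.sum_add_distrib, ← Finset.sum_mul, hsum, one_mul]
        _ ≤ h x + δ + T * δ := by gcongr; exact hdrift x hx
        _ = h x + (T + 1 : ℕ) * δ := by push_cast; ring
    · have h1 := trajProb_le_one hK hsum x (T + 1) fun ω => ∃ t, B (ω t)
      have h2 : 0 ≤ ((T + 1 : ℕ) : ℝ) * δ := by positivity
      linarith

end TrajectoryBounds

section Configurations

variable {V : Type*} {G : SimpleGraph V}

/-- The configuration with a single particle at `u`. -/
def singleConfig (u : V) : V → Bool := fun w => decide (w = u)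

/-- The configuration with particles exactly at `u` and `v`. -/
def pairConfig (u v : V) : V → Bool := fun w => decide (w = u ∨ w = v)

theorem update_singleConfig_true (u v : V) :
    Function.update (singleConfig u) v true = pairConfig u v := by
  ext w
  by_cases h : w = v <;> simp [h, singleConfig, pairConfig, Function.update]

theorem update_singleConfig_false {u v : V} (huv : u ≠ v) :
    Function.update (singleConfig u) v false = singleConfig u := by
  ext w
  by_cases h : w = v <;> simp [h, singleConfig, Function.update, huv.symm]

theorem update_pairConfig_left_true (u v : V) :
    Function.update (pairConfig u v) u true = pairConfig u v := by
  ext w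
  by_cases h : w = u <;> simp [h, pairConfig, Function.update]

theorem update_pairConfig_left_false {u v : V} (huv : u ≠ v) :
    Function.update (pairConfig u v) u false = singleConfig v := by
  ext w
  by_cases h : w = u <;> simp [h, pairConfig, singleConfig, Function.update, huv]

theorem update_pairConfig_false_of_ne {u v w : V} (hu : w ≠ u) (hv : w ≠ v) :
    Function.update (pairConfig u v) w false = pairConfig u v := by
  ext z
  by_cases h : z = w <;> simp [h, pairConfig, Function.update, hu, hv]

theorem pairConfig_comm (u v : V) : pairConfig u v = pairConfig v u := by
  ext w
  simp [pairConfig, or_comm]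

/-- The Lyapunov function: `0` on single particles, `a` on adjacent pairs, `1` elsewhere. -/
def tripleLyapunov (G : SimpleGraph V) (a : ℝ) (x : V → Bool) : ℝ :=
  if ∃ u, x = singleConfig u then 0 else if ∃ u v, G.Adj u v ∧ x = pairConfig u v then a else 1

theorem tripleLyapunov_nonneg {a : ℝ} (ha : 0 ≤ a) (x : V → Bool) : 0 ≤ tripleLyapunov G a x := by
  unfold tripleLyapunov
  split_ifs <;> linarith

theorem tripleLyapunov_le_one {a : ℝ} (ha : a ≤ 1) (x : V → Bool) : tripleLyapunov G a x ≤ 1 := by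
  unfold tripleLyapunov
  split_ifs <;> linarith

theorem tripleLyapunov_singleConfig (a : ℝ) (u : V) : tripleLyapunov G a (singleConfig u) = 0 :=
  if_pos ⟨u, rfl⟩

theorem tripleLyapunov_pairConfig (a : ℝ) {u v : V} (h : G.Adj u v) :
    tripleLyapunov G a (pairConfig u v) = a := by
  unfold tripleLyapunov
  rw [if_neg, if_pos ⟨u, v, h, rfl⟩]
  rintro ⟨w, hw⟩
  have hu : u = w := by simpa [pairConfig, singleConfig] using congrFun hw u
  have hv : v = w := by simpa [pairConfig, singleConfig] using congrFun hw v
  exact h.ne (hu.trans hv.symm)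

end Configurations

section Kernel

variable {V : Type*} [Fintype V] {G : SimpleGraph V} {p : ℝ}

theorem sum_eq_off_vertex (x : V → Bool) (v : V) (F : (V → Bool) → ℝ) :
    (∑ y : V → Bool, if ∀ w, w ≠ v → y w = x w then F y else 0) =
      F (Function.update x v true) + F (Function.update x v false) := by
  rw [← Finset.sum_filter]
  have hset : (Finset.univ.filter fun y : V → Bool => ∀ w, w ≠ v → y w = x w) =
      {Function.update x v true, Function.update x v false} := by
    ext y
    simp only [Finset.mem_filter, Finset.mem_univ, true_and, Finset.mem_insert,
      Finset.mem_singleton, Function.eq_update_iff]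
    cases y v <;> simp
  rw [hset, Finset.sum_pair]
  intro h
  simpa using congrFun h v

theorem sum_kcipKernel_mul (x : V → Bool) (f : (V → Bool) → ℝ) :
    ∑ y, kcipKernel G p x y * f y = ((Fintype.card V : ℝ))⁻¹ * ∑ v : V,
      if ∃ u, G.Adj u v ∧ x u = true then
        p * f (Function.update x v true) + (1 - p) * f (Function.update x v false)
      else f x := by
  unfold kcipKernel
  simp_rw [mul_assoc, ← Finset.mul_sum, Finset.sum_mul]
  rw [Finset.sum_comm]
  congr 1
  refine Finset.sum_congr rfl fun v _ => ?_
  simp_rw [ite_mul, zero_mul]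
  rw [sum_eq_off_vertex]
  by_cases hv : ∃ u, G.Adj u v ∧ x u = true
  · simp [hv]
  · simp only [hv, if_false, Function.update_self]
    cases hx : x v
    · have : Function.update x v false = x := by rw [← hx, Function.update_eq_self]
      simp [this]
    · have : Function.update x v true = x := by rw [← hx, Function.update_eq_self]
      simp [this]

theorem kcipKernel_nonneg (h0 : 0 ≤ p) (h1 : p ≤ 1) (x y : V → Bool) :
    0 ≤ kcipKernel G p x y := by
  refine mul_nonneg (by positivity) (Finset.sum_nonneg fun v _ => ?_)
  split_ifs <;> linarith

theorem sum_kcipKernel [Nonempty V] (x : V → Bool) : ∑ y, kcipKernel G p x y = 1 := by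
  have h := sum_kcipKernel_mul (G := G) (p := p) x fun _ => 1
  simpa using h

theorem exists_eq_singleConfig {x : V → Bool} (hx : numParticles x = 1) :
    ∃ u, x = singleConfig u := by
  obtain ⟨u, hu⟩ := Finset.card_eq_one.1 hx
  refine ⟨u, funext fun w => ?_⟩
  have : x w = true ↔ w = u := by simpa using Finset.ext_iff.1 hu w
  rw [Bool.eq_iff_iff, this]
  simp [singleConfig]

theorem numParticles_pairConfig_le (u v : V) : numParticles (pairConfig u v) ≤ 2 := by
  refine le_trans (Finset.card_le_card (t := {u, v}) fun w hw => ?_) Finset.card_le_two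
  simpa [pairConfig] using hw

theorem numParticles_singleConfig_le (u : V) : numParticles (singleConfig u) ≤ 2 := by
  have : singleConfig u = pairConfig u u := by ext; simp [singleConfig, pairConfig]
  exact this ▸ numParticles_pairConfig_le u u

theorem one_le_tripleLyapunov (a : ℝ) {x : V → Bool} (hx : 3 ≤ numParticles x) :
    1 ≤ tripleLyapunov G a x := by
  unfold tripleLyapunov
  rw [if_neg, if_neg]
  · rintro ⟨u, v, -, rfl⟩
    exact absurd (numParticles_pairConfig_le u v) (by omega)
  · rintro ⟨u, rfl⟩
    exact absurd (numParticles_singleConfig_le u) (by omega)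

theorem sum_adj_indicator [DecidableRel G.Adj] {m : ℕ} (hG : G.IsRegularOfDegree m) (u : V)
    (b : ℝ) : (∑ w : V, if G.Adj u w then b else 0) = m * b := by
  rw [← Finset.sum_filter, Finset.sum_const, nsmul_eq_mul, ← hG u, ← G.card_neighborFinset_eq_degree,
    G.neighborFinset_eq_filter]

theorem drift_singleConfig [DecidableRel G.Adj] {m : ℕ} (hG : G.IsRegularOfDegree m) (a : ℝ)
    (u : V) : ∑ y, kcipKernel G p (singleConfig u) y * tripleLyapunov G a y =
      (Fintype.card V : ℝ)⁻¹ * (m * (p * a)) := by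
  rw [sum_kcipKernel_mul, ← sum_adj_indicator hG u (p * a)]
  congr 1
  refine Finset.sum_congr rfl fun v _ => ?_
  have hiff : (∃ w, G.Adj w v ∧ singleConfig u w = true) ↔ G.Adj u v := by simp [singleConfig]
  by_cases huv : G.Adj u v
  · rw [if_pos (hiff.2 huv), if_pos huv, update_singleConfig_true,
      update_singleConfig_false huv.ne, tripleLyapunov_pairConfig a huv,
      tripleLyapunov_singleConfig]
    ring
  · rw [if_neg (mt hiff.1 huv), if_neg huv, tripleLyapunov_singleConfig]

theorem drift_pairConfig_le [Nonempty V] [DecidableRel G.Adj] {m : ℕ}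
    (hG : G.IsRegularOfDegree m) {a : ℝ} (hp : 0 ≤ p) (ha0 : 0 ≤ a) (ha1 : a ≤ 1)
    (hpa : p * (m - 1) ≤ (1 - p) * a) {u v : V} (huv : G.Adj u v) :
    ∑ y, kcipKernel G p (pairConfig u v) y * tripleLyapunov G a y ≤ a := by
  rw [sum_kcipKernel_mul]
  have hn : (0 : ℝ) < Fintype.card V := by exact_mod_cast Fintype.card_pos
  rw [inv_mul_le_iff₀ hn]
  set b : ℝ := p + (1 - p) * a with hb
  calc _ ≤ ∑ w : V, (a + (if G.Adj u w then p else 0) + (if G.Adj v w then p else 0)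
            - (if w = u then b else 0) - (if w = v then b else 0)) := by
        refine Finset.sum_le_sum fun w _ => ?_
        by_cases hwu : w = u
        · subst hwu
          rw [if_pos ⟨v, huv.symm, by simp [pairConfig]⟩, update_pairConfig_left_true,
            update_pairConfig_left_false huv.ne, tripleLyapunov_pairConfig a huv,
            tripleLyapunov_singleConfig]
          simp only [SimpleGraph.irrefl, huv.symm, huv.ne, if_true, if_false]
          linarith
        by_cases hwv : w = v
        · subst hwv
          rw [if_pos ⟨u, huv, by simp [pairConfig]⟩, pairConfig_comm, update_pairConfig_left_true,
            update_pairConfig_left_false huv.ne.symm, tripleLyapunov_pairConfig a huv.symm,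
            tripleLyapunov_singleConfig]
          simp only [SimpleGraph.irrefl, huv, hwu, if_true, if_false]
          linarith
        have hiff : (∃ z, G.Adj z w ∧ pairConfig u v z = true) ↔ G.Adj u w ∨ G.Adj v w := by
          simp [pairConfig, and_or_left, exists_or]
        rw [update_pairConfig_false_of_ne hwu hwv, tripleLyapunov_pairConfig a huv]
        have h1 := tripleLyapunov_le_one (G := G) ha1 (Function.update (pairConfig u v) w true)
        have h2 := mul_le_mul_of_nonneg_left h1 hp
        have h3 := mul_nonneg hp ha0
        simp only [hiff, hwu, hwv, if_false]
        by_cases hu : G.Adj u w <;> by_cases hv : G.Adj v w <;> simp [hu, hv] <;> linarith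
    _ = Fintype.card V * a + m * p + m * p - b - b := by
        simp only [Finset.sum_sub_distrib, Finset.sum_add_distrib, sum_adj_indicator hG]
        simp
    _ ≤ Fintype.card V * a := by linarith

theorem drift_tripleLyapunov_le [Nonempty V] [DecidableRel G.Adj] {m : ℕ}
    (hG : G.IsRegularOfDegree m) {a : ℝ} (hp : 0 ≤ p) (ha0 : 0 ≤ a) (ha1 : a ≤ 1)
    (hpa : p * (m - 1) ≤ (1 - p) * a) {x : V → Bool} (hx : tripleLyapunov G a x < 1) :
    ∑ y, kcipKernel G p x y * tripleLyapunov G a y ≤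
      tripleLyapunov G a x + (Fintype.card V : ℝ)⁻¹ * (m * (p * a)) := by
  by_cases h1 : ∃ u, x = singleConfig u
  · obtain ⟨u, rfl⟩ := h1
    rw [drift_singleConfig hG, tripleLyapunov_singleConfig, zero_add]
  by_cases h2 : ∃ u v, G.Adj u v ∧ x = pairConfig u v
  · obtain ⟨u, v, huv, rfl⟩ := h2
    rw [tripleLyapunov_pairConfig a huv]
    have h3 : 0 ≤ (Fintype.card V : ℝ)⁻¹ * (m * (p * a)) := by positivity
    linarith [drift_pairConfig_le hG hp ha0 ha1 hpa huv]
  · simp [tripleLyapunov, h1, h2] at hx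

end Kernel

/-- There exist a universal constant `C < ∞` and `ε₀ > 0` (independent of the
graph and of `c`) such that: for every `c > 0`, every integer `m > 1`, every `m`-regular
triangle-free finite graph `G` on `n` vertices with `n` sufficiently large (depending on `c`
and `m`), and every `0 < ε < ε₀`, the KCIP on `G` with `p = c/n` started from a configuration
with exactly one particle satisfies `P[ζ_triple < ε n³/(3c²m(m-1))] ≤ C ε`, where
`ζ_triple = inf {t : V_t ≥ 3}`. -/
theorem kcip_triple_time_lower_bound :
    ∃ C ε₀ : ℝ, 0 < C ∧ 0 < ε₀ ∧
      ∀ c : ℝ, 0 < c → ∀ m : ℕ, 1 < m → ∃ N : ℕ,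
        ∀ (V : Type) (_ : Fintype V) (_ : DecidableEq V) (G : SimpleGraph V)
          (_ : DecidableRel G.Adj),
          N < Fintype.card V → G.IsRegularOfDegree m → G.CliqueFree 3 →
          ∀ ε : ℝ, 0 < ε → ε < ε₀ →
          ∀ x : V → Bool, numParticles x = 1 →
          trajProb (kcipKernel G (c / (Fintype.card V : ℝ))) x
              (⌈ε * (Fintype.card V : ℝ) ^ 3 / (3 * c ^ 2 * m * ((m : ℝ) - 1))⌉₊)
              (fun ω => ∃ t : Fin (⌈ε * (Fintype.card V : ℝ) ^ 3 /
                    (3 * c ^ 2 * m * ((m : ℝ) - 1))⌉₊ + 1),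
                (t : ℝ) < ε * (Fintype.card V : ℝ) ^ 3 / (3 * c ^ 2 * m * ((m : ℝ) - 1)) ∧
                  3 ≤ numParticles (ω t)) ≤
            C * ε := by
  refine ⟨2, 1, by norm_num, by norm_num, fun c hc m hm => ⟨⌈2 * c * m⌉₊, ?_⟩⟩
  intro V _ hdec G _ hn hG _ ε hε _ x hx
  obtain rfl : hdec = fun a b => Classical.propDecidable (a = b) := Subsingleton.elim _ _
  obtain ⟨u, rfl⟩ := exists_eq_singleConfig hx
  have : Nonempty V := ⟨u⟩
  have hm1 : (1 : ℝ) < m := by exact_mod_cast hm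
  have hncard : 2 * c * m < Fintype.card V := Nat.lt_of_ceil_lt hn
  set n : ℝ := (Fintype.card V : ℝ)
  have hn0 : 0 < n := lt_trans (by positivity) hncard
  have hm2 : 0 < (m : ℝ) - 1 := by linarith
  set p : ℝ := c / n with hpdef
  have hp0 : 0 < p := by positivity
  have hpm : p * (2 * m) < 1 := by
    rw [hpdef, div_mul_eq_mul_div, div_lt_one hn0]
    linarith
  have hp1 : p ≤ 1 / 2 := by nlinarith
  set a : ℝ := 2 * p * (m - 1) with hadef
  have ha0 : 0 ≤ a := by positivity
  have ha1 : a ≤ 1 := by rw [hadef]; linarith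
  have hpa : p * (m - 1) ≤ (1 - p) * a := by
    have : 0 ≤ p * (m - 1) * (1 - 2 * p) := by
      refine mul_nonneg (by positivity) (by linarith)
    rw [hadef]
    linarith
  set r : ℝ := ε * n ^ 3 / (3 * c ^ 2 * m * ((m : ℝ) - 1)) with hr
  have hr0 : 0 < r := by positivity
  have hK := kcipKernel_nonneg (G := G) hp0.le (by linarith : p ≤ 1)
  set δ : ℝ := n⁻¹ * (m * (p * a)) with hδ
  have hδ0 : 0 ≤ δ := by positivity
  have hrδ : r * δ = 2 / 3 * ε := by
    rw [hr, hδ, hadef, hpdef]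
    field_simp
  have key := trajProb_hit_le hK sum_kcipKernel (B := fun y => 3 ≤ numParticles y)
    (tripleLyapunov_nonneg ha0) hδ0 (fun _ => one_le_tripleLyapunov a)
    (fun _ => drift_tripleLyapunov_le hG hp0.le ha0 ha1 hpa) (singleConfig u) ⌈r⌉₊
  rw [tripleLyapunov_singleConfig, zero_add] at key
  by_cases hr1 : r ≤ 1
  · have hzero : trajProb (kcipKernel G p) (singleConfig u) ⌈r⌉₊
        (fun ω => ∃ t : Fin (⌈r⌉₊ + 1), (t : ℝ) < r ∧ 3 ≤ numParticles (ω t)) ≤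
        trajProb (kcipKernel G p) (singleConfig u) ⌈r⌉₊ (fun _ => False) := by
      refine trajProb_mono hK _ _ ?_
      rintro ω hω ⟨t, ht, h3⟩
      have ht0 : (t : ℕ) < 1 := by exact_mod_cast ht.trans_le hr1
      have : t = 0 := Fin.ext (by simpa using ht0)
      rw [this, hω, hx] at h3
      omega
    refine hzero.trans ?_
    simp only [trajProb, and_false, if_false, Finset.sum_const_zero]
    positivity
  · have hceil : (⌈r⌉₊ : ℝ) ≤ 2 * r := by linarith [Nat.ceil_lt_add_one hr0.le]
    calc _ ≤ _ := trajProb_mono hK _ _ fun ω _ ⟨t, _, h3⟩ => ⟨t, h3⟩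
      _ ≤ ⌈r⌉₊ * δ := key
      _ ≤ 2 * r * δ := by gcongr
      _ ≤ 2 * ε := by linarith
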